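/- The Apéry power series f = ∑_{n≥0} A_n z^n ∈ ℚ[[z]], where A_n = ∑_{k=0}^{n} C(n,k)^2 · C(n+k,k)^2, is transcendental over ℚ(z); that is, there is no nonzero polynomial P ∈ ℚ[z][Y] with P(f) = 0 in ℚ[[z]]. -/

import Mathlib

/-- A formal power series `f ∈ ℚ[[z]]` is algebraic if it cancels a nonzero
polynomial `P ∈ ℚ[z][Y]`. -/
def PowerSeries.IsAlgebraicSeries (f : PowerSeries ℚ) : Prop :=
  ∃ P : Polynomial (Polynomial ℚ), P ≠ 0 ∧
    Polynomial.eval₂ Polynomial.coeToPowerSeries.ringHom f P = 0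

def apT (n k : ℕ) : ℕ := n.choose k * (n + k).choose k
def apA (n : ℕ) : ℕ := ∑ k ∈ Finset.range (n + 1), (apT n k) ^ 2

lemma apT_zero {n k : ℕ} (h : n < k) : apT n k = 0 := by
  simp [apT, Nat.choose_eq_zero_of_lt h]

lemma apA_eq (n M : ℕ) (h : n < M) : apA n = ∑ k ∈ Finset.range M, (apT n k) ^ 2 := by
  unfold apA
  apply Finset.sum_subset
  · intro x; simp; omega
  · intro x _ hx
    simp at hx
    rw [apT_zero (by omega)]; rfl

lemma apT_cast {n k : ℕ} (h : k ≤ n) :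
    (apT n k : ℚ) = (n + k).factorial / (k.factorial ^ 2 * (n - k).factorial) := by
  unfold apT
  rw [Nat.cast_mul, Nat.cast_choose ℚ h, Nat.cast_choose ℚ (Nat.le_add_left k n)]
  have : n + k - k = n := by omega
  rw [this]
  have := Nat.factorial_ne_zero n
  have := Nat.factorial_ne_zero k
  have := Nat.factorial_ne_zero (n - k)
  field_simp

lemma apT_rel (n k : ℕ) (h : k ≤ n + 2) : ∃ x : ℚ,
    (apT (n+2) k : ℚ) = x * (n + 1 + k) * (n + 2 + k) ∧
    (apT (n+1) k : ℚ) = x * (n + 1 + k) * (n + 2 - k) ∧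
    (apT n k : ℚ) = x * (n + 2 - k) * (n + 1 - k) ∧
    (∀ j, k = j + 1 → (apT (n+1) j : ℚ) = x * k ^ 2) := by
  refine ⟨(n + k).factorial / (k.factorial ^ 2 * (n + 2 - k).factorial), ?_, ?_, ?_, ?_⟩
  · rw [apT_cast h]
    have : n + 2 + k = n + k + 1 + 1 := by ring
    rw [this, Nat.factorial_succ, Nat.factorial_succ]
    push_cast
    ring
  · rcases Nat.lt_or_ge (n+1) k with h1 | h1
    · obtain rfl : k = n + 2 := by omega
      rw [apT_zero h1]; push_cast; ring
    · rw [apT_cast h1]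
      obtain ⟨m, hm⟩ := Nat.exists_eq_add_of_le h1
      have e1 : n + 2 - k = m + 1 := by omega
      have e2 : n + 1 - k = m := by omega
      have e3 : (n : ℚ) + 1 = k + m := by exact_mod_cast hm
      have e4 : n + 1 + k = n + k + 1 := by ring
      rw [e1, e2, e4, Nat.factorial_succ, Nat.factorial_succ]
      have := Nat.factorial_ne_zero m
      have := Nat.factorial_ne_zero k
      have e5 : (n : ℚ) + 2 - k = m + 1 := by linarith
      rw [e5]
      push_cast
      field_simp
      ring
  · rcases Nat.lt_or_ge n k with h1 | h1
    · rw [apT_zero h1]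
      have : k = n + 1 ∨ k = n + 2 := by omega
      rcases this with rfl | rfl <;> push_cast <;> ring
    · rw [apT_cast h1]
      obtain ⟨m, hm⟩ := Nat.exists_eq_add_of_le h1
      have e1 : n + 2 - k = m + 1 + 1 := by omega
      have e2 : n - k = m := by omega
      have e3 : (n : ℚ) = k + m := by exact_mod_cast hm
      rw [e1, e2, Nat.factorial_succ, Nat.factorial_succ]
      have := Nat.factorial_ne_zero m
      have := Nat.factorial_ne_zero k
      have e5 : (n : ℚ) + 2 - k = m + 1 + 1 := by linarith
      have e6 : (n : ℚ) + 1 - k = m + 1 := by linarith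
      rw [e5, e6]
      push_cast
      field_simp
  · rintro j rfl
    rw [apT_cast (by omega)]
    have e1 : n + 2 - (j + 1) = n + 1 - j := by omega
    have e2 : n + (j + 1) = n + 1 + j := by omega
    rw [e1, e2, Nat.factorial_succ]
    have := Nat.factorial_ne_zero (n + 1 - j)
    have := Nat.factorial_ne_zero j
    push_cast
    field_simp

lemma apB_sum (n M : ℕ) (hM : M ≤ n + 2) :
    ∑ k ∈ Finset.range (M + 1), (((n:ℚ)+2)^3 * (apT (n+2) k:ℚ)^2
      - (34*((n:ℚ)+1)^3+51*((n:ℚ)+1)^2+27*((n:ℚ)+1)+5) * (apT (n+1) k:ℚ)^2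
      + ((n:ℚ)+1)^3 * (apT n k:ℚ)^2)
    = 4 * (2 * ((n:ℚ)+1) + 1) * (M * (2 * M + 1) - (2 * ((n:ℚ)+1) + 1)^2) * (apT (n+1) M:ℚ)^2 := by
  induction M with
  | zero =>
    obtain ⟨x, h1, h2, h3, h4⟩ := apT_rel n 0 (by omega)
    simp only [zero_add, Finset.sum_range_one, h1, h2, h3]
    push_cast
    ring
  | succ M ih =>
    rw [Finset.sum_range_succ, ih (by omega)]
    obtain ⟨x, h1, h2, h3, h4⟩ := apT_rel n (M+1) (by omega)
    rw [h4 M rfl, h1, h2, h3]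
    push_cast
    ring

lemma apA_rec (n : ℕ) : ((n:ℤ)+2)^3 * (apA (n+2):ℤ)
      - (34*((n:ℤ)+1)^3+51*((n:ℤ)+1)^2+27*((n:ℤ)+1)+5) * (apA (n+1):ℤ)
      + ((n:ℤ)+1)^3 * (apA n:ℤ) = 0 := by
  have h := apB_sum n (n+2) le_rfl
  rw [apT_zero (show n + 1 < n + 2 by omega)] at h
  rw [Finset.sum_add_distrib, Finset.sum_sub_distrib, ← Finset.mul_sum, ← Finset.mul_sum,
    ← Finset.mul_sum] at h
  have h0 := apA_eq n (n+2+1) (by omega)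
  have h1 := apA_eq (n+1) (n+2+1) (by omega)
  have h2 := apA_eq (n+2) (n+2+1) (by omega)
  have h0' : (apA n : ℚ) = _ := congrArg Nat.cast h0
  have h1' : (apA (n+1) : ℚ) = _ := congrArg Nat.cast h1
  have h2' : (apA (n+2) : ℚ) = _ := congrArg Nat.cast h2
  push_cast at h0' h1' h2' h
  rw [← h0', ← h1', ← h2'] at h
  have h' : ((n:ℚ)+2)^3 * (apA (n+2):ℚ)
      - (34*((n:ℚ)+1)^3+51*((n:ℚ)+1)^2+27*((n:ℚ)+1)+5) * (apA (n+1):ℚ)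
      + ((n:ℚ)+1)^3 * (apA n:ℚ) = 0 := by rw [h]; ring
  exact_mod_cast h'

lemma sum_range_mul_aux {R : Type*} [AddCommMonoid R] (p m : ℕ) (F : ℕ → R) :
    ∑ k ∈ Finset.range (p * m), F k
      = ∑ j ∈ Finset.range m, ∑ i ∈ Finset.range p, F (i + p * j) := by
  induction m with
  | zero => simp
  | succ m ih =>
    rw [Finset.sum_range_succ, ← ih, Nat.mul_succ, Finset.sum_range_add]
    simp only [add_comm]

lemma choose_lucas (p : ℕ) [Fact p.Prime] (a b i j : ℕ) (ha : a < p) (hi : i < p) :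
    ((a + p * b).choose (i + p * j) : ZMod p) = a.choose i * b.choose j := by
  have h := Choose.choose_modEq_choose_mod_mul_choose_div_nat (n := a + p * b) (k := i + p * j) (p := p)
  have hp : 0 < p := by omega
  rw [Nat.add_mul_mod_self_left, Nat.add_mul_mod_self_left, Nat.add_mul_div_left _ _ hp,
    Nat.add_mul_div_left _ _ hp, Nat.mod_eq_of_lt ha, Nat.mod_eq_of_lt hi,
    Nat.div_eq_of_lt ha, Nat.div_eq_of_lt hi, zero_add, zero_add] at h
  have := (ZMod.natCast_eq_natCast_iff _ _ _).2 h
  simpa using this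

lemma apT_lucas (p : ℕ) [Fact p.Prime] (a b i j : ℕ) (ha : a < p) (hi : i < p) :
    (apT (a + p * b) (i + p * j) : ZMod p) = apT a i * apT b j := by
  unfold apT
  push_cast
  rw [choose_lucas p a b i j ha hi]
  have e : a + p * b + (i + p * j) = (a + i) + p * (b + j) := by ring
  rw [e]
  rcases Nat.lt_or_ge (a + i) p with h | h
  · rw [choose_lucas p _ _ i j h hi]; ring
  · obtain ⟨c, hc⟩ := Nat.exists_eq_add_of_le h
    have e2 : a + i + p * (b + j) = c + p * (b + j + 1) := by rw [hc]; ring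
    rw [e2, choose_lucas p _ _ i j (by omega) hi]
    have e3 : ((a + i).choose i : ZMod p) = 0 := by
      have := choose_lucas p c 1 i 0 (by omega) hi
      simp at this
      rw [show a + i = c + p by omega, this, Nat.choose_eq_zero_of_lt (by omega)]
      simp
    rw [e3, Nat.choose_eq_zero_of_lt (show c < i by omega)]
    simp

lemma apA_lucas (p : ℕ) [Fact p.Prime] (a b : ℕ) (ha : a < p) :
    (apA (a + p * b) : ZMod p) = apA a * apA b := by
  rw [apA_eq (a + p * b) (p * (b + 1)) (by rw [Nat.mul_succ]; omega), apA_eq a p ha,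
    apA, Nat.cast_sum, sum_range_mul_aux]
  push_cast
  rw [Finset.sum_mul_sum, Finset.sum_comm]
  refine Finset.sum_congr rfl fun i hi => Finset.sum_congr rfl fun j hj => ?_
  rw [apT_lucas p a b i j ha (Finset.mem_range.1 hi)]
  ring

open Polynomial in
lemma theta_coeff {R : Type*} [CommRing R] (A : R[X]) (n : ℕ) :
    (X * derivative A).coeff n = n * A.coeff n := by
  cases n with
  | zero => simp
  | succ n => rw [coeff_X_mul, coeff_derivative]; push_cast; ring

noncomputable def apPoly (p : ℕ) : Polynomial (ZMod p) :=
  ∑ i ∈ Finset.range p, Polynomial.C (apA i : ZMod p) * Polynomial.X ^ i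

lemma apPoly_coeff (p n : ℕ) : (apPoly p).coeff n = if n < p then (apA n : ZMod p) else 0 := by
  simp [apPoly, Polynomial.coeff_X_pow]

lemma apA_zero : apA 0 = 1 := by decide
lemma apA_one : apA 1 = 5 := by decide

lemma apPoly_rec (p : ℕ) [Fact p.Prime] (n : ℕ) :
    ((n:ZMod p)+2)^3 * (apPoly p).coeff (n+2)
      - (34*((n:ZMod p)+1)^3+51*((n:ZMod p)+1)^2+27*((n:ZMod p)+1)+5) * (apPoly p).coeff (n+1)
      + ((n:ZMod p)+1)^3 * (apPoly p).coeff n = 0 := by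
  have h : ((n:ZMod p)+2)^3 * (apA (n+2):ZMod p)
      - (34*((n:ZMod p)+1)^3+51*((n:ZMod p)+1)^2+27*((n:ZMod p)+1)+5) * (apA (n+1):ZMod p)
      + ((n:ZMod p)+1)^3 * (apA n:ZMod p) = 0 := by
    have := congrArg (Int.cast : ℤ → ZMod p) (apA_rec n)
    push_cast at this
    exact this
  simp only [apPoly_coeff]
  rcases lt_trichotomy (n + 2) p with h1 | h1 | h1
  · rw [if_pos h1, if_pos (by omega), if_pos (by omega)]; exact h
  · have e : ((n:ZMod p)+2) = 0 := by
      have : ((n + 2 : ℕ) : ZMod p) = 0 := by rw [h1]; simp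
      exact_mod_cast this
    rw [if_neg (by omega), if_pos (by omega), if_pos (by omega)]
    rw [e] at h ⊢
    simpa using h
  · rcases Nat.lt_or_ge n p with h2 | h2
    · have e : ((n:ZMod p)+1) = 0 := by
        have : ((n + 1 : ℕ) : ZMod p) = 0 := by rw [show n + 1 = p by omega]; simp
        exact_mod_cast this
      rw [if_neg (by omega), if_neg (by omega), e]; simp
    · rw [if_neg (by omega), if_neg (by omega), if_neg (by omega)]; simp

open Polynomial in
lemma apPoly_ode (p : ℕ) [Fact p.Prime] (hp : 5 < p) :
    X^2 * (1 - 34 * X + X^2) * derivative (derivative (derivative (apPoly p)))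
    + (3 * X - 153 * X^2 + 6 * X^3) * derivative (derivative (apPoly p))
    + (1 - 112 * X + 7 * X^2) * derivative (apPoly p) + (X - 5) * apPoly p = 0 := by
  set A := apPoly p with hA
  have key : X * derivative (X * derivative (X * derivative A))
    - X * (C 34 * (X * derivative (X * derivative (X * derivative A)))
      + C 51 * (X * derivative (X * derivative A)) + C 27 * (X * derivative A) + C 5 * A)
    + X * (X * (X * derivative (X * derivative (X * derivative A))
      + C 3 * (X * derivative (X * derivative A)) + C 3 * (X * derivative A) + A)) = 0 := by
    have c1 := theta_coeff A
    obtain ⟨T1, hT1⟩ : ∃ T, T = X * derivative A := ⟨_, rfl⟩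
    rw [← hT1] at c1 ⊢
    have c2 := theta_coeff T1
    obtain ⟨T2, hT2⟩ : ∃ T, T = X * derivative T1 := ⟨_, rfl⟩
    rw [← hT2] at c2 ⊢
    have c3 := theta_coeff T2
    obtain ⟨T3, hT3⟩ : ∃ T, T = X * derivative T2 := ⟨_, rfl⟩
    rw [← hT3] at c3 ⊢
    ext n
    rcases n with _ | _ | n
    · simp only [coeff_add, coeff_sub, c3, coeff_X_mul_zero]
      simp
    · simp only [coeff_add, coeff_sub, coeff_X_mul, coeff_C_mul, zero_add,
        coeff_X_mul_zero, c3, c2, c1]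
      simp [hA, apPoly_coeff, show 1 < p by omega, show 0 < p by omega, apA_zero, apA_one]
    · simp only [coeff_add, coeff_sub, coeff_X_mul, coeff_C_mul, c3, c2, c1]
      have := apPoly_rec p n
      rw [← hA] at this
      push_cast
      rw [coeff_zero]
      linear_combination this
  apply mul_left_cancel₀ (X_ne_zero (R := ZMod p))
  rw [mul_zero, ← key]
  simp only [derivative_mul, derivative_add, derivative_X, one_mul, map_ofNat]
  ring

open Polynomial in
lemma t_derivative {F : Type*} [CommRing F] (α : F) (m : ℕ) (B : F[X]) :
    (X - C α) * derivative ((X - C α) ^ m * B)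
      = (X - C α) ^ m * ((m : F[X]) * B + (X - C α) * derivative B) := by
  cases m with
  | zero => simp
  | succ m =>
    simp only [derivative_mul, derivative_X_sub_C_pow, Nat.add_sub_cancel]
    push_cast
    simp
    ring

open Polynomial in
lemma mult_lemma {F : Type*} [Field F] (h288 : (288 : F) ≠ 0) (A : F[X])
    (hode : X^2 * (1 - 34 * X + X^2) * derivative (derivative (derivative A))
    + (3 * X - 153 * X^2 + 6 * X^3) * derivative (derivative A)
    + (1 - 112 * X + 7 * X^2) * derivative A + (X - 5) * A = 0)
    (α : F) (hα : α ≠ 0) (m : ℕ) (B : F[X]) (hAB : A = (X - C α) ^ m * B) (hB : B.eval α ≠ 0) :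
    (m : F) * (m - 1) * (m - 2) * (2 * m - 1) = 0 := by
  set t : F[X] := X - C α with ht
  have dt : derivative t = 1 := by simp [ht]
  have evt : t.eval α = 0 := by simp [ht]
  have t0 : t ≠ 0 := X_sub_C_ne_zero α
  set B1 := (m : F[X]) * B + t * derivative B with hB1
  have h1 : t * derivative A = t ^ m * B1 := by rw [hAB]; exact t_derivative α m B
  set B2 := (m : F[X]) * B1 + t * derivative B1 - B1 with hB2
  have h2 : t ^ 2 * derivative (derivative A) = t ^ m * B2 := by
    have e := t_derivative α m B1
    rw [← ht, ← h1, derivative_mul, dt] at e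
    rw [hB2]
    linear_combination e - h1
  set B3 := (m : F[X]) * B2 + t * derivative B2 - 2 * B2 with hB3
  have h3 : t ^ 3 * derivative (derivative (derivative A)) = t ^ m * B3 := by
    have e := t_derivative α m B2
    rw [← ht, ← h2, derivative_mul, derivative_pow, dt] at e
    rw [hB3]
    simp at e
    have c2 : (C 2 : F[X]) = 2 := map_ofNat C 2
    rw [c2] at e
    linear_combination e - 2 * h2
  have e1 : B1.eval α = m * B.eval α := by simp [hB1, evt]
  have e2 : B2.eval α = m * (m - 1) * B.eval α := by simp [hB2, evt, e1]; ring
  have e3 : B3.eval α = m * (m - 1) * (m - 2) * B.eval α := by simp [hB3, evt, e2]; ring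
  have main : X^2 * (1 - 34 * X + X^2) * B3 + t * (3 * X - 153 * X^2 + 6 * X^3) * B2
    + t ^ 2 * (1 - 112 * X + 7 * X^2) * B1 + t ^ 3 * (X - 5) * B = 0 := by
    apply mul_left_cancel₀ (pow_ne_zero m t0)
    linear_combination t ^ 3 * hode - X^2 * (1 - 34 * X + X^2) * h3
      - t * (3 * X - 153 * X^2 + 6 * X^3) * h2 - t ^ 2 * (1 - 112 * X + 7 * X^2) * h1
      - t ^ 3 * (X - 5) * hAB
  by_cases hq : 1 - 34 * α + α ^ 2 = 0
  · have hfac : (1 - 34 * X + X^2 : F[X]) = t * (X + C α - 34) := by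
      have : C (1 - 34 * α + α ^ 2) = (0 : F[X]) := by rw [hq, C_0]
      simp only [C_add, C_sub, C_mul, C_pow, C_1, map_ofNat] at this
      rw [ht]
      linear_combination this
    have main2 : X^2 * (X + C α - 34) * B3 + (3 * X - 153 * X^2 + 6 * X^3) * B2
      + t * (1 - 112 * X + 7 * X^2) * B1 + t ^ 2 * (X - 5) * B = 0 := by
      apply mul_left_cancel₀ t0
      rw [hfac] at main
      linear_combination main
    have ev := congrArg (eval α) main2
    simp [e1, e2, e3, evt] at ev
    have h17 : 17 * α - 1 ≠ 0 := by
      intro h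
      apply h288
      linear_combination (17 * α - 577) * h - 289 * hq
    have : (α * (17 * α - 1) * B.eval α) * ((m:F) * (m - 1) * (2 * m - 1)) = 0 := by
      linear_combination ev - (B.eval α * (m:F) * (m - 1) * (2 * α * (m - 2) + 6 * α)) * hq
    have := (mul_eq_zero.1 this).resolve_left (mul_ne_zero (mul_ne_zero hα h17) hB)
    linear_combination (m - 2 : F) * this
  · have ev := congrArg (eval α) main
    simp [e3, evt] at ev
    have hb : (m : F) * (m - 1) * (m - 2) = 0 := by
      rcases ev with h | h
      · rcases h with h | h
        · exact absurd h hα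
        · exact absurd h hq
      · rcases h with h | h
        · rcases h with (h | h) | h <;> simp [h]
        · exact absurd h hB
    rw [hb, zero_mul]

open PowerSeries in
noncomputable def apSer (p : ℕ) : PowerSeries (ZMod p) := PowerSeries.mk fun n => (apA n : ZMod p)

lemma apSer_pow (p : ℕ) [Fact p.Prime] (n : ℕ) : PowerSeries.coeff n (apSer p ^ p)
    = if p ∣ n then (apA (n / p) : ZMod p) else 0 := by
  have hp : p ≠ 0 := (Fact.out : p.Prime).ne_zero
  have h := MvPowerSeries.map_frobenius_expand p hp (f := apSer p)
  have h2 : PowerSeries.map (frobenius (ZMod p) p) (PowerSeries.expand p hp (apSer p)) = apSer p ^ p := h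
  rw [← h2, PowerSeries.coeff_map, PowerSeries.coeff_expand, ZMod.frobenius_zmod]
  simp [apSer]

lemma apSer_eq (p : ℕ) [Fact p.Prime] : apSer p = (apPoly p : PowerSeries (ZMod p)) * apSer p ^ p := by
  have hp : 0 < p := (Fact.out : p.Prime).pos
  ext n
  rw [PowerSeries.coeff_mul, Finset.sum_eq_single (n % p, p * (n / p))]
  · rw [apSer_pow, Polynomial.coeff_coe, apPoly_coeff, if_pos (Nat.mod_lt _ hp),
      if_pos (Dvd.intro _ rfl), Nat.mul_div_cancel_left _ hp, ← apA_lucas p _ _ (Nat.mod_lt _ hp),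
      Nat.mod_add_div]
    simp [apSer]
  · rintro ⟨i, j⟩ hij hne
    rw [Finset.HasAntidiagonal.mem_antidiagonal] at hij
    simp only at hij ⊢
    rw [apSer_pow, Polynomial.coeff_coe, apPoly_coeff]
    split_ifs with h1 h2
    · exfalso
      obtain ⟨c, rfl⟩ := h2
      apply hne
      subst hij
      rw [Nat.add_mul_mod_self_left, Nat.add_mul_div_left _ _ hp, Nat.mod_eq_of_lt h1,
        Nat.div_eq_of_lt h1, zero_add]
    all_goals simp
  · intro h
    exact absurd (Finset.HasAntidiagonal.mem_antidiagonal.2 (Nat.mod_add_div n p)) h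

lemma apSer_ne (p : ℕ) [Fact p.Prime] : apSer p ≠ 0 := by
  intro h
  have := congrArg (PowerSeries.coeff 0) h
  simp [apSer, apA_zero] at this

lemma apSer_mul (p : ℕ) [Fact p.Prime] :
    (apPoly p : PowerSeries (ZMod p)) * apSer p ^ (p - 1) = 1 := by
  have hp : 0 < p := (Fact.out : p.Prime).pos
  apply mul_right_cancel₀ (apSer_ne p)
  rw [mul_assoc, ← pow_succ, Nat.sub_add_cancel hp, one_mul, ← apSer_eq]

open Polynomial IntermediateField in
lemma field_norm_lemma {K L : Type*} [Field K] [Field L] [Algebra K L] (G : L) (N : ℕ) (a : K)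
    (hG : G ^ N = algebraMap K L a) (Q : K[X]) (hQ0 : Q ≠ 0) (hQ : aeval G Q = 0) :
    ∃ (e : ℕ) (w : K), 1 ≤ e ∧ e ≤ Q.natDegree ∧ w ^ N = a ^ e := by
  have hint : IsIntegral K G := (isAlgebraic_iff_isIntegral).1 ⟨Q, hQ0, hQ⟩
  have hgen : (AdjoinSimple.gen K G) ^ N = algebraMap K K⟮G⟯ a := by
    apply (algebraMap K⟮G⟯ L).injective
    rw [map_pow, AdjoinSimple.algebraMap_gen, hG, ← IsScalarTower.algebraMap_apply]
  have hn := congrArg (Algebra.norm K) hgen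
  rw [map_pow, Algebra.norm_algebraMap, adjoin.finrank hint] at hn
  exact ⟨_, _, minpoly.natDegree_pos hint, natDegree_le_of_dvd (minpoly.dvd _ _ hQ) hQ0, hn⟩

open scoped RatFunc in
open Polynomial IntermediateField in
lemma norm_lemma {F : Type*} [Field F] (g : PowerSeries F) (A : F[X]) (N : ℕ)
    (hA : (A : PowerSeries F) * g ^ N = 1) (P : F[X][X]) (hP : P ≠ 0)
    (hPg : eval₂ coeToPowerSeries.ringHom g P = 0) :
    ∃ (e : ℕ) (u v : F[X]), 1 ≤ e ∧ e ≤ P.natDegree ∧ u ≠ 0 ∧ v ≠ 0 ∧ u ^ N * A ^ e = v ^ N := by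
  let G : (LaurentSeries F) := algebraMap (PowerSeries F) (LaurentSeries F) g
  have hcoe : ∀ q : F[X], algebraMap (PowerSeries F) (LaurentSeries F) (q : PowerSeries F)
      = algebraMap (RatFunc F) (LaurentSeries F) (algebraMap F[X] (RatFunc F) q) := fun q => RatFunc.coe_coe q
  have hA0 : A ≠ 0 := by rintro rfl; simp at hA
  have hAK : algebraMap F[X] (RatFunc F) A ≠ 0 := by
    simpa using hA0
  have hG : G ^ N = algebraMap (RatFunc F) (LaurentSeries F) (algebraMap F[X] (RatFunc F) A)⁻¹ := by
    have := congrArg (algebraMap (PowerSeries F) (LaurentSeries F)) hA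
    rw [map_mul, map_pow, map_one, hcoe] at this
    rw [map_inv₀]
    exact eq_inv_of_mul_eq_one_right this
  let Q : (RatFunc F)[X] := P.map (algebraMap F[X] (RatFunc F))
  have hQ0 : Q ≠ 0 := (Polynomial.map_ne_zero_iff (RatFunc.algebraMap_injective F)).2 hP
  have hQ : aeval G Q = 0 := by
    have := congrArg (algebraMap (PowerSeries F) (LaurentSeries F)) hPg
    rw [map_zero, hom_eval₂] at this
    rw [aeval_def, eval₂_map, ← this]
    congr 1
    refine RingHom.ext fun q => ?_
    exact (hcoe q).symm
  obtain ⟨e, w, he, hdeg, hn⟩ := field_norm_lemma G N _ hG Q hQ0 hQ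
  rw [natDegree_map_eq_of_injective (RatFunc.algebraMap_injective F) P] at hdeg
  obtain ⟨u, v, hv, huv⟩ := IsFractionRing.div_surjective (A := F[X]) w
  have hv0 : v ≠ 0 := nonZeroDivisors.ne_zero hv
  have hvK : algebraMap F[X] (RatFunc F) v ≠ 0 := by simpa using hv0
  have heq : u ^ N * A ^ e = v ^ N := by
    apply RatFunc.algebraMap_injective F
    rw [← huv, div_pow, inv_pow, div_eq_iff (pow_ne_zero _ hvK)] at hn
    rw [map_mul, map_pow, map_pow, map_pow, hn, mul_right_comm,
      inv_mul_cancel₀ (pow_ne_zero _ hAK), one_mul]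
  have hN : u = 0 → N = 0 := by
    rintro rfl
    by_contra h
    rw [zero_pow h, zero_mul] at heq
    exact pow_ne_zero _ hv0 heq.symm
  by_cases hu : u = 0
  · have := hN hu
    subst this
    exact ⟨e, 1, 1, he, hdeg, one_ne_zero, one_ne_zero, by simpa using heq⟩
  · exact ⟨e, u, v, he, hdeg, hu, hv0, heq⟩

open Polynomial in
lemma modp_contra (p : ℕ) [Fact p.Prime] (P : (ZMod p)[X][X]) (hP : P ≠ 0)
    (hp5 : 5 < p) (hpd : 2 * P.natDegree + 1 < p)
    (hPg : eval₂ coeToPowerSeries.ringHom (apSer p) P = 0) : False := by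
  obtain ⟨e, u, v, he1, hed, hu, hv, huv⟩ := norm_lemma (apSer p) (apPoly p) (p - 1) (apSer_mul p) P hP hPg
  have hprime : p.Prime := Fact.out
  let F := AlgebraicClosure (ZMod p)
  let φ := algebraMap (ZMod p) F
  have hφ : Function.Injective φ := φ.injective
  have : CharP F p := charP_of_injective_algebraMap hφ p
  set A := (apPoly p).map φ with hA
  have hc0 : A.coeff 0 = 1 := by
    rw [hA, coeff_map, apPoly_coeff, if_pos (by omega), apA_zero]; simp
  have hA0 : A ≠ 0 := by intro h; simp [h] at hc0
  have hdegA : A.natDegree < p := by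
    rw [hA, natDegree_map, Polynomial.natDegree_lt_iff_degree_lt (by intro h; simp [hA, h] at hA0),
      degree_lt_iff_coeff_zero]
    intro m hm
    rw [apPoly_coeff, if_neg (by omega)]
  have hdeg1 : A.degree ≠ 0 := by
    intro h
    have h1 : A.coeff 1 = 0 := coeff_eq_zero_of_degree_lt (by rw [h]; norm_num)
    rw [hA, coeff_map, apPoly_coeff, if_pos (by omega), apA_one] at h1
    have h5 : ((5 : ℕ) : ZMod p) = 0 := hφ (by rw [h1, map_zero])
    rw [ZMod.natCast_eq_zero_iff] at h5
    exact absurd (Nat.le_of_dvd (by norm_num) h5) (by omega)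
  obtain ⟨α, hα⟩ := IsAlgClosed.exists_root A hdeg1
  have hα0 : α ≠ 0 := by
    rintro rfl
    rw [IsRoot, ← coeff_zero_eq_eval_zero, hc0] at hα
    exact one_ne_zero hα
  set m := A.rootMultiplicity α with hm
  have hm1 : 1 ≤ m := (rootMultiplicity_pos hA0).2 hα
  have hmp : m < p := by
    have := natDegree_le_of_dvd (pow_rootMultiplicity_dvd A α) hA0
    rw [natDegree_pow, natDegree_X_sub_C, mul_one, ← hm] at this
    omega
  obtain ⟨B, hB, hBd⟩ := exists_eq_pow_rootMultiplicity_mul_and_not_dvd A hA0 α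
  rw [dvd_iff_isRoot] at hBd
  have hode := congrArg (Polynomial.map φ) (apPoly_ode p hp5)
  simp only [Polynomial.map_add, Polynomial.map_mul, Polynomial.map_sub, Polynomial.map_pow,
    Polynomial.map_X, Polynomial.map_one, Polynomial.map_ofNat, ← derivative_map,
    Polynomial.map_zero, ← hA] at hode
  have h288 : (288 : F) ≠ 0 := by
    intro h
    have h' : ((288 : ℕ) : F) = 0 := by exact_mod_cast h
    rw [CharP.cast_eq_zero_iff F p] at h'
    have : p ∣ 2 ^ 5 * 3 ^ 2 := by simpa using h'
    rcases (Nat.Prime.dvd_mul hprime).1 this with h | h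
    · have := Nat.le_of_dvd (by norm_num) (hprime.dvd_of_dvd_pow h); omega
    · have := Nat.le_of_dvd (by norm_num) (hprime.dvd_of_dvd_pow h); omega
  have hmul := mult_lemma h288 A hode α hα0 m B hB hBd
  have hdiv : p - 1 ∣ e * m := by
    classical
    have h := congrArg (Polynomial.map φ) huv
    simp only [Polynomial.map_mul, Polynomial.map_pow, ← hA] at h
    have hu' : u.map φ ≠ 0 := (Polynomial.map_ne_zero_iff hφ).2 hu
    have h2 := congrArg (rootMultiplicity α) h
    rw [rootMultiplicity_mul (mul_ne_zero (pow_ne_zero _ hu') (pow_ne_zero _ hA0)),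
      ← count_roots, ← count_roots, ← count_roots, roots_pow, roots_pow, roots_pow,
      Multiset.count_nsmul, Multiset.count_nsmul, Multiset.count_nsmul, count_roots A, ← hm] at h2
    exact (Nat.dvd_add_right (Dvd.intro _ rfl)).1 (h2 ▸ Dvd.intro _ rfl)
  have hcast : ∀ k : ℕ, (k : F) = 0 → p ∣ k := fun k h => (CharP.cast_eq_zero_iff F p k).1 h
  have h2e : p - 1 ∣ 2 * e := by
    rcases mul_eq_zero.1 hmul with h | h
    · have hm12 : m = 1 ∨ m = 2 := by
        rcases mul_eq_zero.1 h with h | h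
        · rcases mul_eq_zero.1 h with h | h
          · have := Nat.le_of_dvd hm1 (hcast m h); omega
          · left
            have := hcast (m - 1) (by rw [Nat.cast_sub hm1]; push_cast; exact h)
            by_contra hne
            have := Nat.le_of_dvd (by omega) this
            omega
        · by_cases h1 : m = 1
          · exact Or.inl h1
          · right
            have := hcast (m - 2) (by rw [Nat.cast_sub (by omega)]; push_cast; exact h)
            by_contra hne
            have := Nat.le_of_dvd (by omega) this
            omega
      rcases hm12 with h | h
      · rw [h, mul_one] at hdiv; exact hdiv.mul_left 2
      · rw [h, mul_comm] at hdiv; exact hdiv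
    · have := hcast (2 * m - 1) (by
        rw [Nat.cast_sub (by omega), Nat.cast_mul, Nat.cast_ofNat, Nat.cast_one]; exact h)
      obtain ⟨c, hc⟩ := this
      have hc1 : c = 1 := by
        have : c < 2 := by
          by_contra hcc
          have : p * 2 ≤ p * c := Nat.mul_le_mul_left p (by omega)
          omega
        have : c ≠ 0 := by rintro rfl; omega
        omega
      rw [hc1, mul_one] at hc
      have h3 : 2 * (e * m) = e * (p - 1) + 2 * e := by
        have : 2 * m = (p - 1) + 2 := by omega
        calc 2 * (e * m) = e * (2 * m) := by ring
          _ = _ := by rw [this]; ring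
      have h4 : p - 1 ∣ e * (p - 1) + 2 * e := h3 ▸ hdiv.mul_left 2
      exact (Nat.dvd_add_right (Dvd.intro_left _ rfl)).1 h4
  have := Nat.le_of_dvd (by omega) h2e
  omega

open Polynomial in
lemma to_int (f : PowerSeries ℤ) (P : ℚ[X][X]) (hP : P ≠ 0)
    (h : eval₂ coeToPowerSeries.ringHom (f.map (Int.castRingHom ℚ)) P = 0) :
    ∃ Q : ℤ[X][X], Q ≠ 0 ∧ eval₂ coeToPowerSeries.ringHom f Q = 0 := by
  let : Algebra ℤ[X] ℚ[X] := Polynomial.algebra ℤ ℚ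
  let M := (nonZeroDivisors ℤ).map (C : ℤ →+* ℤ[X])
  have : IsLocalization M ℚ[X] := Polynomial.isLocalization _ _
  have hM : M ≤ nonZeroDivisors ℤ[X] := by
    rintro _ ⟨x, hx, rfl⟩
    rw [mem_nonZeroDivisors_iff_ne_zero]
    have := nonZeroDivisors.ne_zero hx
    simpa using this
  refine ⟨IsLocalization.integerNormalization M P, ?_, ?_⟩
  · intro h0
    exact hP ((IsLocalization.integerNormalization_eq_zero_iff (M := M) hM P).1 h0)
  · have h2 := IsLocalization.integerNormalization_eval₂_eq_zero M coeToPowerSeries.ringHom P h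
    apply PowerSeries.map_injective (Int.castRingHom ℚ) (Int.cast_injective)
    rw [map_zero, hom_eval₂, ← h2]
    congr 1
    refine RingHom.ext fun q => ?_
    ext n
    simp [Polynomial.algebraMap_def]

open Polynomial in
lemma apery_aux :
    ¬ PowerSeries.IsAlgebraicSeries (PowerSeries.mk fun n =>
      ((∑ k ∈ Finset.range (n + 1),
        (n.choose k) ^ 2 * ((n + k).choose k) ^ 2 : ℕ) : ℚ)) := by
  rintro ⟨P, hP, h⟩
  obtain ⟨Q, hQ, hQf⟩ := to_int (PowerSeries.mk fun n => (apA n : ℤ)) P hP (by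
    rw [← h]
    congr 1
    ext n
    simp [apA, apT, mul_pow])
  obtain ⟨i, hi⟩ : ∃ i, Q.coeff i ≠ 0 := by
    by_contra hh
    push Not at hh
    exact hQ (by ext1 i; simpa using hh i)
  obtain ⟨j, hj⟩ : ∃ j, (Q.coeff i).coeff j ≠ 0 := by
    by_contra hh
    push Not at hh
    exact hi (by ext1 i; simpa using hh i)
  obtain ⟨p, hp, hprime⟩ := Nat.exists_infinite_primes
    (((Q.coeff i).coeff j).natAbs + 2 * Q.natDegree + 7)
  have : Fact p.Prime := ⟨hprime⟩
  let ψ := Int.castRingHom (ZMod p)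
  refine modp_contra p (Q.map (mapRingHom ψ)) ?_ (by omega) ?_ ?_
  · intro h0
    have := congrArg (fun R : (ZMod p)[X][X] => (R.coeff i).coeff j) h0
    simp only [coeff_map, coe_mapRingHom, coeff_zero] at this
    rw [eq_intCast, ZMod.intCast_zmod_eq_zero_iff_dvd] at this
    have := Nat.le_of_dvd (Int.natAbs_pos.2 hj) (Int.natCast_dvd.1 this)
    omega
  · have := natDegree_map_le (f := mapRingHom ψ) (p := Q)
    omega
  · have h2 := congrArg (PowerSeries.map ψ) hQf
    rw [map_zero, hom_eval₂] at h2
    rw [eval₂_map, ← h2]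
    congr 1
    · refine RingHom.ext fun q => ?_
      ext n
      simp
    · ext n
      simp [apSer]

/-- The Apéry power series is transcendental. -/
theorem apery_series_transcendental :
    ¬ PowerSeries.IsAlgebraicSeries (PowerSeries.mk fun n =>
      ((∑ k ∈ Finset.range (n + 1),
        (n.choose k) ^ 2 * ((n + k).choose k) ^ 2 : ℕ) : ℚ)) :=
  apery_aux
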